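/- arXiv:2109.13583 — 2 statements merged into one kernel-verified Lean document; each statement's English description precedes it below -/
import Mathlib

section
/- On the hexagonal lattice: suppose the inverse temperature sequence β = β_L satisfies L^{2/3} ≪ e^{β_L}. Then the partition function satisfies Z_{β_L} = q + o_L(1) and the Gibbs measure concentrates on the ground states: μ_{β_L}(S) = 1 − o_L(1) as L → ∞. -/
open scoped Classical BigOperators

namespace IsingHex

/-- Sites of the hexagonal lattice of side length `L` with periodic boundary conditions,
identified with the `2L²` triangular faces of the dual triangular lattice `Λ*`:
`(p, false)` is the up-triangle and `(p, true)` the down-triangle in the rhombic cell `p`. -/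
abbrev Site (L : ℕ) : Type := (ZMod L × ZMod L) × Bool

/-- Spin configurations `X = Ω^Λ` with spin set `Ω = Fin q`. -/
abbrev Conf (L q : ℕ) : Type := Site L → Fin q

/-- Adjacency of the hexagonal lattice: the up-triangle `(p, false)` is adjacent to the
down-triangles `(p, true)`, `(p - (1,0), true)` and `(p - (0,1), true)`. -/
def hexAdj {L : ℕ} (v w : Site L) : Prop :=
  (v.2 = false ∧ w.2 = true ∧
     (w.1 = v.1 ∨ w.1 = (v.1.1 - 1, v.1.2) ∨ w.1 = (v.1.1, v.1.2 - 1))) ∨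
  (v.2 = true ∧ w.2 = false ∧
     (v.1 = w.1 ∨ v.1 = (w.1.1 - 1, w.1.2) ∨ v.1 = (w.1.1, w.1.2 - 1)))

/-- The Hamiltonian `H(σ)`: the number of edges of `Λ` whose endpoints carry different
spins; each edge is counted exactly once through its unique up-triangle endpoint. -/
noncomputable def Ham (L q : ℕ) (σ : Conf L q) : ℕ :=
  Nat.card {e : Site L × Site L // e.1.2 = false ∧ hexAdj e.1 e.2 ∧ σ e.1 ≠ σ e.2}

/-- The monochromatic ground state `𝐚`. -/
def groundConf (L q : ℕ) (a : Fin q) : Conf L q := fun _ => a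

/-- The set `S = {𝟏, …, 𝐪}` of ground states. -/
def groundSet (L q : ℕ) : Set (Conf L q) := {σ | ∃ a : Fin q, σ = groundConf L q a}

/-- Partition function `Z_β`. -/
noncomputable def Zfun (L q : ℕ) (β : ℝ) : ℝ :=
  ∑' σ : Conf L q, Real.exp (-β * (Ham L q σ : ℝ))

/-- Gibbs measure of a set of configurations. -/
noncomputable def gibbsP (L q : ℕ) (β : ℝ) (A : Set (Conf L q)) : ℝ :=
  (∑' σ : Conf L q, A.indicator (fun ζ => Real.exp (-β * (Ham L q ζ : ℝ))) σ) / Zfun L q β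

/-- `σ ∼ ζ`: the two configurations differ at exactly one site. -/
def oneFlip {L q : ℕ} (σ ζ : Conf L q) : Prop :=
  ∃ x : Site L, σ x ≠ ζ x ∧ ∀ y : Site L, y ≠ x → σ y = ζ y

/-- Metropolis jump rates `c_β(σ, ζ)`. -/
noncomputable def rate (L q : ℕ) (β : ℝ) (σ ζ : Conf L q) : ℝ :=
  if oneFlip σ ζ then Real.exp (-β * max ((Ham L q ζ : ℝ) - (Ham L q σ : ℝ)) 0) else 0

/-- There is a `t`-path of single spin flips connecting `σ` and `ζ`. -/
def ConnBelow (L q : ℕ) (t : ℕ) (σ ζ : Conf L q) : Prop :=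
  ∃ (N : ℕ) (ω : ℕ → Conf L q), ω 0 = σ ∧ ω N = ζ ∧
    (∀ n < N, oneFlip (ω n) (ω (n + 1))) ∧ ∀ n ≤ N, Ham L q (ω n) ≤ t

/-- Communication height `Φ(σ, ζ)`. -/
noncomputable def commHeight (L q : ℕ) (σ ζ : Conf L q) : ℕ :=
  sInf {t : ℕ | ConnBelow L q t σ ζ}

/-- The strip of index `ℓ` in direction `d` (`0` = horizontal, `1` = vertical,
`2` = diagonal): `2L` consecutive triangles winding around the torus. -/
def stripSet (L : ℕ) (d : Fin 3) (ℓ : ZMod L) : Set (Site L) :=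
  if d = 0 then {v | v.1.2 = ℓ}
  else if d = 1 then {v | v.1.1 = ℓ}
  else {v | (v.2 = false ∧ v.1.1 + v.1.2 = ℓ) ∨ (v.2 = true ∧ v.1.1 + v.1.2 = ℓ - 1)}

/-- Strip energy `ΔH_s(σ)`: number of adjacent pairs inside the strip with different spins. -/
noncomputable def stripEnergy (L q : ℕ) (σ : Conf L q) (d : Fin 3) (ℓ : ZMod L) : ℕ :=
  Nat.card {e : Site L × Site L //
    e.1.2 = false ∧ e.1 ∈ stripSet L d ℓ ∧ e.2 ∈ stripSet L d ℓ ∧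
      hexAdj e.1 e.2 ∧ σ e.1 ≠ σ e.2}

/-- The strip `(d, ℓ)` is an `a`-bridge of `σ`. -/
def IsBridgeWith (L q : ℕ) (σ : Conf L q) (d : Fin 3) (ℓ : ZMod L) (a : Fin q) : Prop :=
  ∀ v ∈ stripSet L d ℓ, σ v = a

/-- The strip `(d, ℓ)` is a bridge of `σ`. -/
def IsBridge (L q : ℕ) (σ : Conf L q) (d : Fin 3) (ℓ : ZMod L) : Prop :=
  ∃ a : Fin q, IsBridgeWith L q σ d ℓ a

/-- Cyclic enumeration of the strip `(d, ℓ)` by `ZMod (2L)`, consecutive triangles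
being adjacent. -/
def stripCycle (L : ℕ) (d : Fin 3) (ℓ : ZMod L) (k : ZMod (2 * L)) : Site L :=
  let t : ZMod L := ((k.val / 2 : ℕ) : ZMod L)
  if d = 0 then ((t, ℓ), decide (k.val % 2 = 1))
  else if d = 1 then ((ℓ, t), decide (k.val % 2 = 1))
  else if k.val % 2 = 1 then ((t, ℓ - 1 - t), true) else ((t, ℓ - t), false)

/-- A set of triangles is an arc (a set of consecutive triangles) of the strip `(d, ℓ)`. -/
def IsArc (L : ℕ) (d : Fin 3) (ℓ : ZMod L) (S : Set (Site L)) : Prop :=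
  ∃ (s : ZMod (2 * L)) (m : ℕ),
    S = (fun k : ℕ => stripCycle L d ℓ (s + (k : ZMod (2 * L)))) '' Set.Iio m

/-- The strip `(d, ℓ)` is an `{a,b}`-semibridge of `σ`: it carries exactly the two
spins `a ≠ b`, and the sites carrying each spin are consecutive in the strip. -/
def IsSemibridgePair (L q : ℕ) (σ : Conf L q) (d : Fin 3) (ℓ : ZMod L) (a b : Fin q) : Prop :=
  a ≠ b ∧ (∀ v ∈ stripSet L d ℓ, σ v = a ∨ σ v = b) ∧
    (∃ v ∈ stripSet L d ℓ, σ v = a) ∧ (∃ v ∈ stripSet L d ℓ, σ v = b) ∧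
    IsArc L d ℓ {v ∈ stripSet L d ℓ | σ v = a} ∧ IsArc L d ℓ {v ∈ stripSet L d ℓ | σ v = b}

/-- The strip `(d, ℓ)` is a semibridge of `σ`. -/
def IsSemibridge (L q : ℕ) (σ : Conf L q) (d : Fin 3) (ℓ : ZMod L) : Prop :=
  ∃ a b : Fin q, IsSemibridgePair L q σ d ℓ a b

/-- `σ` has an `a`-cross: two `a`-bridges in different directions. -/
def HasCross (L q : ℕ) (σ : Conf L q) (a : Fin q) : Prop :=
  ∃ (d d' : Fin 3) (ℓ ℓ' : ZMod L),
    d ≠ d' ∧ IsBridgeWith L q σ d ℓ a ∧ IsBridgeWith L q σ d' ℓ' a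

/-- `σ` is cross-free. -/
def CrossFree (L q : ℕ) (σ : Conf L q) : Prop := ∀ a : Fin q, ¬ HasCross L q σ a

/-- Connected subsets of the torus `𝕋_L` of strip indices (the collection `𝔖_L`). -/
def CircConn (L : ℕ) (P : Set (ZMod L)) : Prop :=
  ∀ x ∈ P, ∀ y ∈ P, ∃ (N : ℕ) (γ : ℕ → ZMod L), γ 0 = x ∧ γ N = y ∧
    (∀ n ≤ N, γ n ∈ P) ∧ ∀ n < N, γ (n + 1) = γ n + 1 ∨ γ (n + 1) = γ n - 1

/-- Union of the strips with indices in `P`, in direction `d`. -/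
def stripUnion (L : ℕ) (d : Fin 3) (P : Set (ZMod L)) : Set (Site L) :=
  ⋃ ℓ ∈ P, stripSet L d ℓ

/-- The configuration `ξ^{a,b}_U`: spin `b` on `U` and spin `a` elsewhere. -/
noncomputable def xiConf (L q : ℕ) (a b : Fin q) (U : Set (Site L)) : Conf L q :=
  fun v => if v ∈ U then b else a

/-- `σ ∈ R_n^{a,b}`: a regular configuration between `𝐚` and `𝐛` built from `n` strips. -/
def IsRegular (L q : ℕ) (σ : Conf L q) (a b : Fin q) (n : ℕ) : Prop :=
  ∃ (d : Fin 3) (P : Set (ZMod L)), CircConn L P ∧ P.ncard = n ∧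
    σ = xiConf L q a b (stripUnion L d P)

/-- The vertices (in the triangular lattice) of the triangle `v`. -/
def triVerts (L : ℕ) (v : Site L) : Set (ZMod L × ZMod L) :=
  if v.2 = false then {v.1, (v.1.1 + 1, v.1.2), (v.1.1, v.1.2 + 1)}
  else {(v.1.1 + 1, v.1.2), (v.1.1, v.1.2 + 1), (v.1.1 + 1, v.1.2 + 1)}

/-- A connected set of triangles (connected through shared sides). -/
def ConnSet (L : ℕ) (U : Set (Site L)) : Prop :=
  ∀ x ∈ U, ∀ y ∈ U, ∃ (N : ℕ) (γ : ℕ → Site L), γ 0 = x ∧ γ N = y ∧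
    (∀ n ≤ N, γ n ∈ U) ∧ ∀ n < N, hexAdj (γ n) (γ (n + 1))

/-- A one-dimensional canonical set inside the strip `(d, ℓ)`. -/
def OneDimCanonical (L : ℕ) (d : Fin 3) (ℓ : ZMod L) (U : Set (Site L)) : Prop :=
  U ⊆ stripSet L d ℓ ∧ U.Nonempty ∧ U ≠ stripSet L d ℓ ∧
  (ConnSet L U ∨
    (Even U.ncard ∧ ∃ (U₁ : Set (Site L)) (y : Site L),
      U = U₁ ∪ {y} ∧ y ∉ U₁ ∧ U₁.Nonempty ∧ ConnSet L U₁ ∧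
      (∀ x ∈ U₁, ¬ hexAdj x y) ∧ ∃ x ∈ U₁, (triVerts L x ∩ triVerts L y).Nonempty))

/-- `P ≺ P'`: connected index sets with `P ⊆ P'` and `|P'| = |P| + 1`. -/
def StepPair (L : ℕ) (P P' : Set (ZMod L)) : Prop :=
  CircConn L P ∧ CircConn L P' ∧ P ⊆ P' ∧ P'.ncard = P.ncard + 1

/-- A protuberance attached to `s(P)` inside the strip `(d, ℓ)`: a one-dimensional
canonical set such that, when `1 ≤ |P| ≤ L-2`, at least half of its triangles share a
side with `s(P)`. -/
def IsProtuberance (L : ℕ) (d : Fin 3) (P : Set (ZMod L)) (ℓ : ZMod L)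
    (U : Set (Site L)) : Prop :=
  OneDimCanonical L d ℓ U ∧
    (1 ≤ P.ncard → P.ncard ≤ L - 2 →
      U.ncard ≤ 2 * {x ∈ U | ∃ y ∈ stripUnion L d P, hexAdj x y}.ncard)

/-- `‖σ‖_a`: the number of sites with spin `a`. -/
noncomputable def spinCount (L q : ℕ) (σ : Conf L q) (a : Fin q) : ℕ :=
  Nat.card {x : Site L // σ x = a}

/-- `N̂(S)`: configurations connected to a ground state by a `(2L+2)`-path. -/
def NHatGround (L q : ℕ) : Set (Conf L q) :=
  {ζ | ∃ a : Fin q, ConnBelow L q (2 * L + 2) (groundConf L q a) ζ}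

/-- A nice pair of configurations (relative to the partition class `A`). -/
def NicePair (L q : ℕ) (A : Finset (Fin q)) (σ ζ : Conf L q) : Prop :=
  σ ∉ NHatGround L q ∧ ζ ∉ NHatGround L q ∧ oneFlip σ ζ ∧
    (∑ a ∈ A, spinCount L q σ a) = L ^ 2 ∧ (∑ a ∈ A, spinCount L q ζ a) = L ^ 2 - 1

/-- `u` is the vector of mean hitting times `σ ↦ E_σ[τ_A]` of the Metropolis dynamics:
it vanishes on `A` and satisfies the first-step (harmonicity) equations off `A`. -/
def IsMeanHittingTime (L q : ℕ) (β : ℝ) (A : Set (Conf L q)) (u : Conf L q → ℝ) : Prop :=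
  (∀ σ ∈ A, u σ = 0) ∧
    ∀ σ ∉ A, (∑' ζ : Conf L q, rate L q β σ ζ) * u σ =
      1 + ∑' ζ : Conf L q, rate L q β σ ζ * u ζ

/-- Gibbs weight `μ_β(σ)`. -/
noncomputable def gibbsWeight (L q : ℕ) (β : ℝ) (σ : Conf L q) : ℝ :=
  Real.exp (-β * (Ham L q σ : ℝ)) / Zfun L q β

/-- The Dirichlet form `D_β(f)`. -/
noncomputable def dirichletForm (L q : ℕ) (β : ℝ) (f : Conf L q → ℝ) : ℝ :=
  (1 / 2) * ∑' p : Conf L q × Conf L q,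
    gibbsWeight L q β p.1 * rate L q β p.1 p.2 * (f p.2 - f p.1) ^ 2

/-- `h` is the equilibrium potential `h^β_{A,B}(σ) = P_σ[τ_A < τ_B]`: it equals `1` on
`A`, `0` on `B`, and is harmonic for the Metropolis dynamics off `A ∪ B`. -/
def IsEqPotential (L q : ℕ) (β : ℝ) (A B : Set (Conf L q)) (h : Conf L q → ℝ) : Prop :=
  (∀ σ ∈ A, h σ = 1) ∧ (∀ σ ∈ B, h σ = 0) ∧
    ∀ σ, σ ∉ A → σ ∉ B → (∑' ζ : Conf L q, rate L q β σ ζ * (h σ - h ζ)) = 0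



section Aux

open Finset

/-- Decomposition of an admissible set into local pieces of size at least three. -/
lemma decomp {V : Type} [Fintype V] (Nb : V → Finset V) (E : Finset V)
    (hE : ∀ e ∈ E, ∃ T ⊆ E, e ∈ T ∧ 3 ≤ T.card ∧ T ⊆ Nb e) :
    ∃ Q : Finset (Finset V), Q.biUnion id = E ∧ (∑ P ∈ Q, P.card) = E.card ∧
      ∀ P ∈ Q, 3 ≤ P.card ∧ ∃ c, P ⊆ univ.filter (fun e => ¬ Disjoint (Nb e) (Nb c)) := by
  choose! T hTE heT hT3 hTN using hE
  have hfin : ((E.powerset.filter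
      (fun M => ∀ c ∈ M, ∀ d ∈ M, c ≠ d → Disjoint (T c) (T d)))).Nonempty :=
    ⟨∅, by simp⟩
  obtain ⟨M, hM, hmax⟩ := Finset.exists_max_image _ Finset.card hfin
  simp only [mem_filter, mem_powerset] at hM hmax
  obtain ⟨hME, hdis⟩ := hM
  have hex : ∀ e ∈ E, ∃ c ∈ M, ¬ Disjoint (T e) (T c) := by
    intro e he
    by_cases heM : e ∈ M
    · refine ⟨e, heM, ?_⟩
      rw [Finset.not_disjoint_iff]
      exact ⟨e, heT e he, heT e he⟩
    by_contra hcon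
    push Not at hcon
    have := hmax (insert e M) ⟨?_, ?_⟩
    · rw [Finset.card_insert_of_notMem heM] at this
      omega
    · exact Finset.insert_subset he hME
    · intro c hc d hd hcd
      rw [Finset.mem_insert] at hc hd
      rcases hc with rfl | hc
      · rcases hd with rfl | hd
        · exact absurd rfl hcd
        · exact hcon d hd
      · rcases hd with rfl | hd
        · exact (hcon c hc).symm
        · exact hdis c hc d hd hcd
  have hex2 : ∀ e ∈ E, ∃ c ∈ M, ¬ Disjoint (T e) (T c) ∧ ∀ d ∈ M, e ∈ T d → d = c := by
    intro e he
    by_cases h : ∃ d ∈ M, e ∈ T d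
    · obtain ⟨d, hd, hed⟩ := h
      refine ⟨d, hd, ?_, ?_⟩
      · rw [Finset.not_disjoint_iff]
        exact ⟨e, heT e he, hed⟩
      · intro d' hd' hed'
        by_contra hne
        exact (Finset.disjoint_left.mp (hdis d' hd' d hd hne)) hed' hed
    · obtain ⟨c, hc, hcd⟩ := hex e he
      refine ⟨c, hc, hcd, ?_⟩
      intro d hd hed
      exact absurd ⟨d, hd, hed⟩ h
  choose! π hπM hπd hπu using hex2
  have hsub : ∀ c ∈ M, T c ⊆ E.filter (fun e => π e = c) := by
    intro c hc e he
    have heE := hTE c (hME hc) he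
    rw [mem_filter]
    exact ⟨heE, (hπu e heE c hc he).symm⟩
  have hinj : Set.InjOn (fun c => E.filter (fun e => π e = c)) (M : Set V) := by
    intro c hc d hd hcd
    have h1 := hsub c hc (heT c (hME hc))
    simp only at hcd
    rw [mem_filter] at h1
    have h2 := h1
    rw [← mem_filter (p := fun e => π e = c), hcd, mem_filter] at h2
    exact h1.2.symm.trans h2.2
  refine ⟨M.image (fun c => E.filter (fun e => π e = c)), ?_, ?_, ?_⟩
  · ext e
    simp only [mem_biUnion, mem_image, id]
    constructor
    · rintro ⟨_, ⟨c, _, rfl⟩, h⟩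
      exact (mem_filter.mp h).1
    · intro he
      exact ⟨_, ⟨π e, hπM e he, rfl⟩, mem_filter.mpr ⟨he, rfl⟩⟩
  · rw [Finset.sum_image hinj]
    exact (Finset.card_eq_sum_card_fiberwise (fun e he => hπM e he)).symm
  · intro P hP
    rw [mem_image] at hP
    obtain ⟨c, hc, rfl⟩ := hP
    refine ⟨(hT3 c (hME hc)).trans (card_le_card (hsub c hc)), c, ?_⟩
    intro e he
    rw [mem_filter] at he ⊢
    refine ⟨mem_univ _, ?_⟩
    intro hd
    apply hπd e he.1
    rw [he.2]
    exact Finset.disjoint_of_subset_left (hTN e he.1)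
      (Finset.disjoint_of_subset_right (hTN c (hME hc)) hd)

/-- Abstract Peierls bound. -/
lemma peierls {V : Type} [Fintype V] (Nb : V → Finset V) (K : ℕ)
    (hK : ∀ c, (univ.filter (fun e => ¬ Disjoint (Nb e) (Nb c))).card ≤ K)
    (x : ℝ) (hx0 : 0 ≤ x) (hx1 : x ≤ 1) (A : Finset (Finset V))
    (hA : ∀ E ∈ A, E.Nonempty ∧ ∀ e ∈ E, ∃ T ⊆ E, e ∈ T ∧ 3 ≤ T.card ∧ T ⊆ Nb e) :
    ∑ E ∈ A, x ^ E.card ≤ Real.exp (Fintype.card V * 2 ^ K * x ^ 3) - 1 := by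
  have hdec := fun E (hE : E ∈ A) => decomp Nb E (hA E hE).2
  choose! Q hQU hQs hQP using hdec
  set F : Finset (Finset V) := univ.filter (fun P => 3 ≤ P.card ∧
    ∃ c, P ⊆ univ.filter (fun e => ¬ Disjoint (Nb e) (Nb c))) with hF
  have hFcard : (F.card : ℝ) ≤ Fintype.card V * 2 ^ K := by
    have h1 : F ⊆ univ.biUnion
        (fun c => (univ.filter (fun e => ¬ Disjoint (Nb e) (Nb c))).powerset) := by
      intro P hP
      rw [hF, mem_filter] at hP
      obtain ⟨_, _, c, hc⟩ := hP
      rw [mem_biUnion]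
      exact ⟨c, mem_univ _, mem_powerset.mpr hc⟩
    have h2 : F.card ≤ Fintype.card V * 2 ^ K := by
      refine (card_le_card h1).trans ?_
      refine Finset.card_biUnion_le_card_mul _ _ _ ?_
      intro c _
      rw [card_powerset]
      exact Nat.pow_le_pow_right (by norm_num) (hK c)
    exact_mod_cast h2
  have hinj : Set.InjOn Q (A : Set (Finset V)) := by
    intro E hE E' hE' h
    rw [← hQU E hE, ← hQU E' hE', h]
  have hsum : ∑ E ∈ A, x ^ E.card = ∑ R ∈ A.image Q, ∏ P ∈ R, x ^ P.card := by
    rw [Finset.sum_image hinj]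
    refine Finset.sum_congr rfl fun E hE => ?_
    rw [Finset.prod_pow_eq_pow_sum, hQs E hE]
  have hsub : A.image Q ⊆ F.powerset.erase ∅ := by
    intro R hR
    rw [mem_image] at hR
    obtain ⟨E, hE, rfl⟩ := hR
    rw [mem_erase, mem_powerset]
    constructor
    · intro h0
      have := hQU E hE
      rw [h0] at this
      have hne := (hA E hE).1
      rw [← this] at hne
      simp at hne
    · intro P hP
      rw [hF, mem_filter]
      exact ⟨mem_univ _, hQP E hE P hP⟩
  have hle : ∑ R ∈ A.image Q, ∏ P ∈ R, x ^ P.card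
      ≤ ∑ R ∈ F.powerset.erase ∅, ∏ P ∈ R, x ^ P.card :=
    Finset.sum_le_sum_of_subset_of_nonneg hsub
      (fun R _ _ => Finset.prod_nonneg fun P _ => pow_nonneg hx0 _)
  have htot : ∑ R ∈ F.powerset.erase ∅, ∏ P ∈ R, x ^ P.card
      = ∏ P ∈ F, (1 + x ^ P.card) - 1 := by
    rw [Finset.prod_one_add, ← Finset.add_sum_erase _ _ (Finset.empty_mem_powerset F)]
    simp
  rw [hsum]
  refine hle.trans ?_
  rw [htot]
  have hprod : ∏ P ∈ F, (1 + x ^ P.card) ≤ Real.exp (Fintype.card V * 2 ^ K * x ^ 3) := by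
    calc ∏ P ∈ F, (1 + x ^ P.card) ≤ ∏ P ∈ F, Real.exp (x ^ 3) := by
          refine Finset.prod_le_prod (fun P _ => by positivity) fun P hP => ?_
          rw [hF, mem_filter] at hP
          have h1 : x ^ P.card ≤ x ^ 3 := pow_le_pow_of_le_one hx0 hx1 hP.2.1
          have h2 := Real.add_one_le_exp (x ^ 3)
          linarith
      _ = Real.exp (F.card * x ^ 3) := by
          rw [Finset.prod_const, ← Real.exp_nat_mul]
      _ ≤ _ := by
          apply Real.exp_le_exp.mpr
          exact mul_le_mul_of_nonneg_right hFcard (by positivity)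
  linarith

/-- Edges of the lattice: base cell and type. -/
abbrev Edg (L : ℕ) : Type := (ZMod L × ZMod L) × Fin 3

/-- The down-triangle endpoint of an edge. -/
def dn {L : ℕ} (p : ZMod L × ZMod L) (i : Fin 3) : Site L :=
  (if i = 0 then p else if i = 1 then (p.1 - 1, p.2) else (p.1, p.2 - 1), true)

/-- An edge is broken. -/
def Brk {L q : ℕ} (σ : Conf L q) (e : Edg L) : Prop := σ (e.1, false) ≠ σ (dn e.1 e.2)

/-- Local neighbourhood of an edge. -/
noncomputable def nb {L : ℕ} (e : Edg L) : Finset (Edg L) :=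
  (univ : Finset ((Fin 3 × Fin 3) × Fin 3)).image
    (fun t => ((e.1.1 + (t.1.1.val : ZMod L) - 1, e.1.2 + (t.1.2.val : ZMod L) - 1), t.2))

lemma nb_meet {L : ℕ} (a b : ZMod L) (i : Fin 3) (c : Edg L)
    (h : ∃ y, y ∈ nb ((a, b), i) ∧ y ∈ nb c) :
    ∃ t s : Fin 3 × Fin 3,
      c.1.1 + (s.1.val : ZMod L) - 1 = a + (t.1.val : ZMod L) - 1 ∧
      c.1.2 + (s.2.val : ZMod L) - 1 = b + (t.2.val : ZMod L) - 1 := by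
  obtain ⟨y, hy1, hy2⟩ := h
  simp only [nb, mem_image, mem_univ, true_and] at hy1 hy2
  obtain ⟨t, rfl⟩ := hy1
  obtain ⟨s, hs⟩ := hy2
  simp only [Prod.mk.injEq] at hs
  exact ⟨t.1, s.1, hs.1.1, hs.1.2⟩

lemma card_le_of_cover {V T : Type} [Fintype T] (A : Finset V) (f : T → V)
    (h : ∀ e ∈ A, ∃ t, f t = e) : A.card ≤ Fintype.card T := by
  have h2 : A ⊆ (univ : Finset T).image f := by
    intro e he
    obtain ⟨t, ht⟩ := h e he
    exact mem_image.mpr ⟨t, mem_univ _, ht⟩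
  exact (card_le_card h2).trans card_image_le

lemma nb_card {L : ℕ} [NeZero L] (c : Edg L) :
    ((univ : Finset (Edg L)).filter (fun e => ¬ Disjoint (nb e) (nb c))).card ≤
      Fintype.card (((Fin 3 × Fin 3) × (Fin 3 × Fin 3)) × Fin 3) := by
  refine card_le_of_cover _
    (fun t : ((Fin 3 × Fin 3) × (Fin 3 × Fin 3)) × Fin 3 =>
      (((c.1.1 + (t.1.1.1.val : ZMod L) - (t.1.2.1.val : ZMod L),
        c.1.2 + (t.1.1.2.val : ZMod L) - (t.1.2.2.val : ZMod L)), t.2) : Edg L)) ?_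
  rintro ⟨⟨a, b⟩, i⟩ he
  have he' := (mem_filter.mp he).2
  rw [Finset.not_disjoint_iff] at he'
  obtain ⟨t, s, h1, h2⟩ := nb_meet a b i c he'
  refine ⟨((s, t), i), ?_⟩
  simp only [Prod.mk.injEq, and_true]
  constructor
  · linear_combination h1
  · linear_combination h2

lemma mem_nb {L : ℕ} (p r : ZMod L × ZMod L) (i j : Fin 3)
    (h1 : r.1 = p.1 - 1 ∨ r.1 = p.1 ∨ r.1 = p.1 + 1)
    (h2 : r.2 = p.2 - 1 ∨ r.2 = p.2 ∨ r.2 = p.2 + 1) : (r, j) ∈ nb (p, i) := by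
  have key : ∀ x y : ZMod L, (x = y - 1 ∨ x = y ∨ x = y + 1) →
      ∃ k : Fin 3, y + (k.val : ZMod L) - 1 = x := by
    rintro x y (h | h | h)
    · exact ⟨0, by subst h; simp⟩
    · exact ⟨1, by subst h; simp⟩
    · exact ⟨2, by subst h; norm_num; ring⟩
  obtain ⟨k, hk⟩ := key _ _ h1
  obtain ⟨l, hl⟩ := key _ _ h2
  simp only [nb, mem_image, mem_univ, true_and]
  exact ⟨((k, l), j), by simp [hk, hl]⟩

/-- The six edges of the hexagon around the dual vertex `(a, b)`. -/
def hexE {L : ℕ} (a b : ZMod L) (e : Edg L) : Prop :=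
  e = ((a, b), 1) ∨ e = ((a - 1, b), 0) ∨ e = ((a - 1, b), 2) ∨
  e = ((a, b - 1), 1) ∨ e = ((a, b - 1), 0) ∨ e = ((a, b), 2)

lemma hex_two {L q : ℕ} (σ : Conf L q) (h1 : (1 : ZMod L) ≠ 0) (a b : ZMod L) (e : Edg L)
    (he : hexE a b e) (hb : Brk σ e) : ∃ f, hexE a b f ∧ f ≠ e ∧ Brk σ f := by
  have n1 : a - 1 ≠ a := by simpa using h1
  have n2 : b - 1 ≠ b := by simpa using h1
  by_contra hcon
  push Not at hcon
  have H : ∀ f, hexE a b f → f ≠ e → σ (f.1, false) = σ (dn f.1 f.2) := by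
    intro f hf hfe
    have := hcon f hf hfe
    unfold Brk at this
    simpa using this
  have e1 := H ((a, b), 1) (by simp [hexE])
  have e2 := H ((a - 1, b), 0) (by simp [hexE])
  have e3 := H ((a - 1, b), 2) (by simp [hexE])
  have e4 := H ((a, b - 1), 1) (by simp [hexE])
  have e5 := H ((a, b - 1), 0) (by simp [hexE])
  have e6 := H ((a, b), 2) (by simp [hexE])
  unfold Brk at hb
  rcases he with rfl | rfl | rfl | rfl | rfl | rfl <;>
    simp [dn, n1, n2, n1.symm, n2.symm] at e1 e2 e3 e4 e5 e6 hb <;> grind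

lemma hex_pair {L : ℕ} (h1 : (1 : ZMod L) ≠ 0) (h2 : (2 : ZMod L) ≠ 0) (e : Edg L) :
    ∃ a b a' b' : ZMod L, hexE a b e ∧ hexE a' b' e ∧
      (∀ f, hexE a b f → hexE a' b' f → f = e) ∧
      (∀ f, hexE a b f → f ∈ nb e) ∧ (∀ f, hexE a' b' f → f ∈ nb e) := by
  obtain ⟨⟨x, y⟩, i⟩ := e
  have n1 : x + 1 ≠ x - 1 := fun h => h2 (by linear_combination h)
  have n2 : y + 1 ≠ y - 1 := fun h => h2 (by linear_combination h)
  have hi : i = 0 ∨ i = 1 ∨ i = 2 := by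
    fin_cases i <;> simp
  rcases hi with rfl | rfl | rfl
  · refine ⟨x + 1, y, x, y + 1, ?_, ?_, ?_, ?_, ?_⟩
    · simp [hexE]
    · simp [hexE]
    · rintro f (rfl | rfl | rfl | rfl | rfl | rfl) h <;>
        simp [hexE] at h ⊢ <;> grind
    · rintro f (rfl | rfl | rfl | rfl | rfl | rfl) <;> apply mem_nb <;> simp
    · rintro f (rfl | rfl | rfl | rfl | rfl | rfl) <;> apply mem_nb <;> simp
  · refine ⟨x, y, x, y + 1, ?_, ?_, ?_, ?_, ?_⟩
    · simp [hexE]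
    · simp [hexE]
    · rintro f (rfl | rfl | rfl | rfl | rfl | rfl) h <;>
        simp [hexE] at h ⊢ <;> grind
    · rintro f (rfl | rfl | rfl | rfl | rfl | rfl) <;> apply mem_nb <;> simp
    · rintro f (rfl | rfl | rfl | rfl | rfl | rfl) <;> apply mem_nb <;> simp
  · refine ⟨x, y, x + 1, y, ?_, ?_, ?_, ?_, ?_⟩
    · simp [hexE]
    · simp [hexE]
    · rintro f (rfl | rfl | rfl | rfl | rfl | rfl) h <;>
        simp [hexE] at h ⊢ <;> grind
    · rintro f (rfl | rfl | rfl | rfl | rfl | rfl) <;> apply mem_nb <;> simp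
    · rintro f (rfl | rfl | rfl | rfl | rfl | rfl) <;> apply mem_nb <;> simp

/-- The set of broken edges. -/
noncomputable def brokenSet {L q : ℕ} [NeZero L] (σ : Conf L q) : Finset (Edg L) :=
  univ.filter (fun e => Brk σ e)

lemma mem_brokenSet {L q : ℕ} [NeZero L] (σ : Conf L q) (e : Edg L) :
    e ∈ brokenSet σ ↔ Brk σ e := by
  unfold brokenSet
  rw [mem_filter]
  exact ⟨fun h => h.2, fun h => ⟨mem_univ _, h⟩⟩

lemma broken_triple {L q : ℕ} [NeZero L] (h1 : (1 : ZMod L) ≠ 0) (h2 : (2 : ZMod L) ≠ 0)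
    (σ : Conf L q) (e : Edg L) (he : e ∈ brokenSet σ) :
    ∃ T ⊆ brokenSet σ, e ∈ T ∧ 3 ≤ T.card ∧ T ⊆ nb e := by
  have hb : Brk σ e := (mem_brokenSet σ e).mp he
  obtain ⟨a, b, a', b', he1, he2, hu, hn1, hn2⟩ := hex_pair h1 h2 e
  obtain ⟨f, hf, hfe, hfb⟩ := hex_two σ h1 a b e he1 hb
  obtain ⟨g, hg, hge, hgb⟩ := hex_two σ h1 a' b' e he2 hb
  have hfg : f ≠ g := by
    rintro rfl
    exact hfe (hu f hf hg)
  refine ⟨{e, f, g}, ?_, by simp, ?_, ?_⟩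
  · intro z hz
    simp only [mem_insert, mem_singleton] at hz
    rcases hz with rfl | rfl | rfl <;> simp [mem_brokenSet, hb, hfb, hgb]
  · rw [Finset.card_eq_three.mpr ⟨e, f, g, hfe.symm, hge.symm, hfg, rfl⟩]
  · intro z hz
    simp only [mem_insert, mem_singleton] at hz
    rcases hz with rfl | rfl | rfl
    · exact hn1 _ he1
    · exact hn1 _ hf
    · exact hn2 _ hg

/-- Connectivity of the lattice. -/
lemma site_conn {L : ℕ} [NeZero L] (P : Site L → Prop) (h0 : P ((0, 0), false))
    (hP : ∀ e : Edg L, P (e.1, false) ↔ P (dn e.1 e.2)) : ∀ v, P v := by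
  have ha : ∀ a b : ZMod L, P ((a, b), false) → P ((a + 1, b), false) := by
    intro a b h
    have e1 := hP ((a, b), 0)
    have e2 := hP ((a + 1, b), 1)
    simp [dn] at e1 e2
    exact e2.mpr (e1.mp h)
  have hb : ∀ a b : ZMod L, P ((a, b), false) → P ((a, b + 1), false) := by
    intro a b h
    have e1 := hP ((a, b), 0)
    have e2 := hP ((a, b + 1), 2)
    simp [dn] at e1 e2
    exact e2.mpr (e1.mp h)
  have hn : ∀ m n : ℕ, P (((m : ZMod L), (n : ZMod L)), false) := by
    intro m n
    induction m with
    | zero =>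
      induction n with
      | zero => simpa using h0
      | succ n ih => rw [Nat.cast_succ]; exact hb _ _ ih
    | succ m ih => rw [Nat.cast_succ]; exact ha _ _ ih
  have hall : ∀ p : ZMod L × ZMod L, P (p, false) := by
    rintro ⟨a, b⟩
    have := hn a.val b.val
    rwa [ZMod.natCast_zmod_val, ZMod.natCast_zmod_val] at this
  rintro ⟨p, b⟩
  cases b with
  | false => exact hall p
  | true =>
    have := (hP (p, 0)).mp (hall p)
    simpa [dn] using this

lemma broken_nonempty {L q : ℕ} [NeZero L] (σ : Conf L q) (h : σ ∉ groundSet L q) :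
    (brokenSet σ).Nonempty := by
  by_contra hne
  rw [Finset.not_nonempty_iff_eq_empty] at hne
  apply h
  refine ⟨σ ((0, 0), false), ?_⟩
  funext v
  refine site_conn (fun v => σ v = groundConf L q (σ ((0, 0), false)) v) rfl ?_ v
  intro e
  have he : e ∉ brokenSet σ := by simp [hne]
  simp only [mem_brokenSet, Brk, not_not] at he
  simp [groundConf, he]

lemma count_broken {L q : ℕ} [NeZero L] (E : Finset (Edg L)) :
    ((univ : Finset (Conf L q)).filter (fun σ => brokenSet σ = E)).card
      ≤ q * (q * q) ^ E.card := by
  have hcard : Fintype.card (Fin q × (E → Fin q × Fin q)) = q * (q * q) ^ E.card := by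
    simp
  rw [← hcard, ← Finset.card_univ]
  refine Finset.card_le_card_of_injOn
    (fun σ => (σ ((0, 0), false), fun e : E => (σ (e.1.1, false), σ (dn e.1.1 e.1.2))))
    (fun _ _ => mem_univ _) ?_
  intro σ hσ τ hτ hst
  simp only [coe_filter, mem_univ, true_and, Set.mem_ofPred_eq] at hσ hτ
  simp only [Prod.mk.injEq] at hst
  obtain ⟨h0, hE⟩ := hst
  funext v
  refine site_conn (fun v => σ v = τ v) h0 ?_ v
  intro e
  by_cases he : e ∈ E
  · have := congrFun hE ⟨e, he⟩
    simp only [Prod.mk.injEq] at this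
    simp [this.1, this.2]
  · have h1 : e ∉ brokenSet σ := by rwa [hσ]
    have h2 : e ∉ brokenSet τ := by rwa [hτ]
    simp only [mem_brokenSet, Brk, not_not] at h1 h2
    simp [h1, h2]

lemma card_le_Ham {L q : ℕ} [NeZero L] (h1 : (1 : ZMod L) ≠ 0) (σ : Conf L q) :
    (brokenSet σ).card ≤ Ham L q σ := by
  unfold Ham
  have hc : Nat.card {e // e ∈ brokenSet σ} = (brokenSet σ).card := by
    simp
  rw [← hc]
  refine Nat.card_le_card_of_injective
    (fun e => ⟨((e.1.1, false), dn e.1.1 e.1.2), rfl, ?_, ?_⟩) ?_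
  · left
    refine ⟨rfl, rfl, ?_⟩
    have hi : e.1.2 = 0 ∨ e.1.2 = 1 ∨ e.1.2 = 2 := by
      generalize e.1.2 = i
      fin_cases i <;> simp
    rcases hi with hi | hi | hi <;> simp [dn, hi]
  · have := e.2
    rw [mem_brokenSet] at this
    exact this
  · rintro ⟨⟨⟨a, b⟩, i⟩, h⟩ ⟨⟨⟨a', b'⟩, i'⟩, h'⟩ hh
    simp only [Subtype.mk.injEq, Prod.mk.injEq, and_true] at hh ⊢
    obtain ⟨⟨rfl, rfl⟩, hd⟩ := hh
    refine ⟨⟨rfl, rfl⟩, ?_⟩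
    clear h h' hc
    have h1' := h1.symm
    fin_cases i <;> fin_cases i' <;> simp [dn, h1] at hd ⊢ <;>
      exact h1 (by linear_combination hd)

lemma Ham_ground {L q : ℕ} (a : Fin q) : Ham L q (groundConf L q a) = 0 := by
  simp [Ham, groundConf]

lemma rest_bound {L q : ℕ} [NeZero L] (h1 : (1 : ZMod L) ≠ 0) (h2 : (2 : ZMod L) ≠ 0)
    (K : ℕ)
    (hK : ∀ c : Edg L, ((univ : Finset (Edg L)).filter
      (fun e => ¬ Disjoint (nb e) (nb c))).card ≤ K)
    (β : ℝ) (hβ : 0 ≤ β) (hx : (q * q : ℝ) * Real.exp (-β) ≤ 1) :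
    ∑ σ ∈ (univ : Finset (Conf L q)).filter (fun σ => σ ∉ groundSet L q),
      Real.exp (-β * (Ham L q σ : ℝ)) ≤
    q * (Real.exp ((3 * L ^ 2 : ℝ) * 2 ^ K * ((q * q : ℝ) * Real.exp (-β)) ^ 3) - 1) := by
  set S := (univ : Finset (Conf L q)).filter (fun σ => σ ∉ groundSet L q) with hS
  set y := Real.exp (-β) with hy
  have hy0 : 0 < y := Real.exp_pos _
  have hy1 : y ≤ 1 := by rw [hy]; exact Real.exp_le_one_iff.mpr (by linarith)
  have hV : (Fintype.card (Edg L) : ℝ) = 3 * L ^ 2 := by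
    simp [ZMod.card]; ring
  have step1 : ∑ σ ∈ S, Real.exp (-β * (Ham L q σ : ℝ)) ≤ ∑ σ ∈ S, y ^ (brokenSet σ).card := by
    refine Finset.sum_le_sum fun σ _ => ?_
    rw [mul_comm, Real.exp_nat_mul]
    exact pow_le_pow_of_le_one hy0.le hy1 (card_le_Ham h1 σ)
  have step2 : ∑ σ ∈ S, y ^ (brokenSet σ).card ≤
      ∑ E ∈ S.image brokenSet, (q : ℝ) * ((q * q : ℝ) * y) ^ E.card := by
    rw [← Finset.sum_fiberwise_of_maps_to (g := brokenSet) (t := S.image brokenSet)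
      (fun σ hσ => mem_image_of_mem _ hσ)]
    refine Finset.sum_le_sum fun E _ => ?_
    have hc : ∑ σ ∈ S.filter (fun σ => brokenSet σ = E), y ^ (brokenSet σ).card
        = (S.filter (fun σ => brokenSet σ = E)).card * y ^ E.card := by
      rw [← nsmul_eq_mul, ← Finset.sum_const]
      refine Finset.sum_congr rfl fun σ hσ => ?_
      rw [(mem_filter.mp hσ).2]
    rw [hc, mul_pow, ← mul_assoc]
    refine mul_le_mul_of_nonneg_right ?_ (by positivity)
    have h3 : (S.filter (fun σ => brokenSet σ = E)).card ≤ q * (q * q) ^ E.card := by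
      refine le_trans (card_le_card ?_) (count_broken (q := q) E)
      exact Finset.filter_subset_filter _ (Finset.subset_univ _)
    exact_mod_cast h3
  refine step1.trans (step2.trans ?_)
  rw [← Finset.mul_sum]
  refine mul_le_mul_of_nonneg_left ?_ (by positivity)
  rw [← hV]
  refine peierls nb K (fun c => by convert hK c) _ (by positivity) hx _ ?_
  intro E hE
  rw [mem_image] at hE
  obtain ⟨σ, hσ, rfl⟩ := hE
  exact ⟨broken_nonempty σ (mem_filter.mp hσ).2, fun e he => broken_triple h1 h2 σ e he⟩

lemma ground_sum {L q : ℕ} [NeZero L] (β : ℝ) :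
    ∑ σ ∈ (univ : Finset (Conf L q)).filter (fun σ => σ ∈ groundSet L q),
      Real.exp (-β * (Ham L q σ : ℝ)) = q := by
  have h : (univ : Finset (Conf L q)).filter (fun σ => σ ∈ groundSet L q)
      = (univ : Finset (Fin q)).image (groundConf L q) := by
    ext σ
    rw [mem_filter, mem_image]
    constructor
    · rintro ⟨_, a, ha⟩
      exact ⟨a, mem_univ _, ha.symm⟩
    · rintro ⟨a, _, ha⟩
      exact ⟨mem_univ _, a, ha.symm⟩
  rw [h, Finset.sum_image]
  · simp [Ham_ground]
  · intro a _ b _ hab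
    exact congrFun hab ((0, 0), false)

end Aux

/-- Theorem 3.2(1) (hexagonal lattice): if `L^{2/3} ≪ e^{β_L}` then `Z_β = q + o_L(1)`
and the Gibbs measure concentrates on the ground states, `μ_β(S) = 1 - o_L(1)`. -/
theorem gibbs_concentration_low_temp (q : ℕ) (hq : 2 ≤ q) (β : ℕ → ℝ)
    (hβ : Filter.Tendsto β Filter.atTop Filter.atTop)
    (hcond : Filter.Tendsto (fun L : ℕ => (L : ℝ) ^ ((2 : ℝ) / 3) / Real.exp (β L))
      Filter.atTop (nhds 0)) :
    Filter.Tendsto (fun L : ℕ => Zfun L q (β L)) Filter.atTop (nhds (q : ℝ)) ∧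
    Filter.Tendsto (fun L : ℕ => gibbsP L q (β L) (groundSet L q))
      Filter.atTop (nhds 1) := by
  obtain ⟨K, hK⟩ : ∃ K : ℕ, ∀ (L : ℕ) [NeZero L] (c : Edg L),
      ((Finset.univ : Finset (Edg L)).filter (fun e => ¬ Disjoint (nb e) (nb c))).card ≤ K :=
    ⟨_, fun L _ c => nb_card c⟩
  have hx : Filter.Tendsto (fun L : ℕ => (q * q : ℝ) * Real.exp (-β L)) Filter.atTop (nhds 0) := by
    have := (Real.tendsto_exp_neg_atTop_nhds_zero.comp hβ).const_mul (q * q : ℝ)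
    simpa using this
  have hb : Filter.Tendsto (fun L : ℕ => (q : ℝ) * (Real.exp ((3 * L ^ 2 : ℝ) * 2 ^ K *
      ((q * q : ℝ) * Real.exp (-β L)) ^ 3) - 1)) Filter.atTop (nhds 0) := by
    have h1 : Filter.Tendsto (fun L : ℕ => (3 * 2 ^ K * (q * q : ℝ) ^ 3) *
        ((L : ℝ) ^ ((2 : ℝ) / 3) / Real.exp (β L)) ^ 3) Filter.atTop (nhds 0) := by
      have := (hcond.pow 3).const_mul (3 * 2 ^ K * (q * q : ℝ) ^ 3)
      rwa [zero_pow (by norm_num), mul_zero] at this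
    have h2 : (fun L : ℕ => (3 * 2 ^ K * (q * q : ℝ) ^ 3) *
        ((L : ℝ) ^ ((2 : ℝ) / 3) / Real.exp (β L)) ^ 3) = (fun L : ℕ => (3 * L ^ 2 : ℝ) * 2 ^ K *
      ((q * q : ℝ) * Real.exp (-β L)) ^ 3) := by
      funext L
      have h3 : ((L : ℝ) ^ ((2 : ℝ) / 3)) ^ 3 = (L : ℝ) ^ 2 := by
        rw [← Real.rpow_natCast, ← Real.rpow_mul (Nat.cast_nonneg L), ← Real.rpow_natCast]
        norm_num
      rw [div_eq_mul_inv, ← Real.exp_neg, mul_pow ((L : ℝ) ^ ((2 : ℝ) / 3)), h3]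
      ring
    rw [h2] at h1
    have h4 := (((Real.continuous_exp.tendsto 0).comp h1).sub_const 1).const_mul (q : ℝ)
    simpa [Function.comp_def] using h4
  have hfin : ∀ᶠ L : ℕ in Filter.atTop, ∃ r : ℝ, 0 ≤ r ∧
      r ≤ (q : ℝ) * (Real.exp ((3 * L ^ 2 : ℝ) * 2 ^ K *
        ((q * q : ℝ) * Real.exp (-β L)) ^ 3) - 1) ∧ Zfun L q (β L) = q + r ∧
      gibbsP L q (β L) (groundSet L q) = q / Zfun L q (β L) := by
    filter_upwards [Filter.eventually_ge_atTop 3, hβ.eventually_ge_atTop 0,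
      hx.eventually_le_const (show (0 : ℝ) < 1 by norm_num)] with L hL hβ0 hx1
    have : NeZero L := ⟨by omega⟩
    have h1 : (1 : ZMod L) ≠ 0 := by
      intro h
      have h' : ((1 : ℕ) : ZMod L) = 0 := by exact_mod_cast h
      rw [ZMod.natCast_eq_zero_iff] at h'
      have := Nat.le_of_dvd (by norm_num) h'
      omega
    have h2 : (2 : ZMod L) ≠ 0 := by
      intro h
      have h' : ((2 : ℕ) : ZMod L) = 0 := by exact_mod_cast h
      rw [ZMod.natCast_eq_zero_iff] at h'
      have := Nat.le_of_dvd (by norm_num) h'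
      omega
    refine ⟨_, Finset.sum_nonneg fun σ _ => (Real.exp_pos _).le,
      rest_bound h1 h2 K (hK L) (β L) hβ0 hx1, ?_, ?_⟩
    · unfold Zfun
      rw [tsum_fintype, ← ground_sum (L := L) (q := q) (β L),
        Finset.sum_filter_add_sum_filter_not]
    · unfold gibbsP
      congr 1
      rw [tsum_fintype, ← ground_sum (L := L) (q := q) (β L), Finset.sum_filter]
      refine Finset.sum_congr rfl fun σ _ => ?_
      rw [Set.indicator_apply]
  have hZ : Filter.Tendsto (fun L : ℕ => Zfun L q (β L)) Filter.atTop (nhds (q : ℝ)) := by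
    have hup := hb.const_add (q : ℝ)
    rw [add_zero] at hup
    refine tendsto_of_tendsto_of_tendsto_of_le_of_le' tendsto_const_nhds hup ?_ ?_
    · filter_upwards [hfin] with L hL
      obtain ⟨r, h0, _, hz, _⟩ := hL
      linarith
    · filter_upwards [hfin] with L hL
      obtain ⟨r, _, h1, hz, _⟩ := hL
      linarith
  refine ⟨hZ, ?_⟩
  have hq0 : (q : ℝ) ≠ 0 := by
    have : q ≠ 0 := by omega
    exact_mod_cast this
  have hdiv := (tendsto_const_nhds (x := (q : ℝ))).div hZ hq0
  rw [div_self hq0] at hdiv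
  refine hdiv.congr' ?_
  filter_upwards [hfin] with L hL
  obtain ⟨r, _, _, _, hg⟩ := hL
  rw [hg]
  rfl

end IsingHex
end

section
/- On the hexagonal lattice: there exists an integer θ > 1, independent of L, such that for all L ≥ 8 and all i ∈ ℕ with i ≥ 1, the number of configurations of energy i satisfies |X_i| ≤ q^{i+1} · Σ binom(θL², n₃) binom(θL², n₄) binom(θL², n₅) binom(θL², n₆), where the sum is over all nonnegative integers n₃, n₄, n₅, n₆ with 3n₃ + 4n₄ + 5n₅ + 6n₆ = i. (Here θ may be chosen so that the dual triangular lattice Λ* has at most θL² connected edge sets with at most 6 edges.) -/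
open scoped Classical BigOperators

namespace IsingHex

/-! ### Proof of the counting bound -/

section Abstract
variable {α : Type*}

/-- `D` splits into disjoint pieces with 3 to 6 elements, each satisfying `Loc`. -/
def Good (Loc : Finset α → Prop) (D : Finset α) : Prop :=
  ∃ P : Finset (Finset α), (∀ p ∈ P, 3 ≤ p.card ∧ p.card ≤ 6 ∧ Loc p) ∧
    P.biUnion id = D ∧ ∑ p ∈ P, p.card = D.card

lemma Good.union {Loc : Finset α → Prop} {D₁ D₂ : Finset α} (h₁ : Good Loc D₁)
    (h₂ : Good Loc D₂) (hd : Disjoint D₁ D₂) : Good Loc (D₁ ∪ D₂) := by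
  obtain ⟨P, hP, hPu, hPs⟩ := h₁
  obtain ⟨Q, hQ, hQu, hQs⟩ := h₂
  have hPQ : Disjoint P Q := by
    rw [Finset.disjoint_left]
    intro p hp hq
    have h3 := (hP p hp).1
    obtain ⟨x, hx⟩ := Finset.card_pos.1 (show 0 < p.card by omega)
    have h1 : x ∈ D₁ := by rw [← hPu]; exact Finset.mem_biUnion.2 ⟨p, hp, hx⟩
    have h2 : x ∈ D₂ := by rw [← hQu]; exact Finset.mem_biUnion.2 ⟨p, hq, hx⟩
    exact Finset.disjoint_left.1 hd h1 h2
  refine ⟨P ∪ Q, ?_, ?_, ?_⟩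
  · intro p hp
    rcases Finset.mem_union.1 hp with h | h
    · exact hP p h
    · exact hQ p h
  · rw [Finset.union_biUnion, hPu, hQu]
  · rw [Finset.sum_union hPQ, Finset.card_union_of_disjoint hd, hPs, hQs]

lemma Good.empty (Loc : Finset α → Prop) : Good Loc ∅ := ⟨∅, by simp, by simp, by simp⟩

lemma good_of_loc {Loc : Finset α → Prop} (hmono : ∀ p p', p ⊆ p' → Loc p' → Loc p) :
    ∀ (n : ℕ) (C : Finset α), C.card = n → 3 ≤ C.card → Loc C → Good Loc C := by
  intro n
  induction n using Nat.strong_induction_on with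
  | _ n ih =>
    intro C hn h3 hL
    by_cases h6 : C.card ≤ 6
    · exact ⟨{C}, by simp [h3, h6, hL], by simp, by simp⟩
    · obtain ⟨A, hA, hA3⟩ := Finset.exists_subset_card_eq h3
      have hc : (C \ A).card = C.card - 3 := by rw [Finset.card_sdiff_of_subset hA, hA3]
      have h1 : Good Loc A := ⟨{A}, by simp [hA3, hmono A C hA hL], by simp, by simp⟩
      have h2 : Good Loc (C \ A) :=
        ih (C \ A).card (by omega) _ rfl (by omega) (hmono _ C Finset.sdiff_subset hL)
      have := h1.union h2 Finset.disjoint_sdiff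
      rwa [Finset.union_sdiff_of_subset hA] at this

lemma good_of_balls {Loc : Finset α → Prop} (hmono : ∀ p p', p ⊆ p' → Loc p' → Loc p)
    (G : Finset α) (B : α → Finset α) (hB : ∀ e ∈ G, B e ⊆ G) (hself : ∀ e ∈ G, e ∈ B e)
    (h3 : ∀ e ∈ G, 3 ≤ (B e).card)
    (hloc : ∀ s ∈ G, Loc (G.filter fun e => ¬ Disjoint (B e) (B s))) : Good Loc G := by
  obtain ⟨S, hS, hmax⟩ := Finset.exists_max_image
    (G.powerset.filter fun S => ∀ s ∈ S, ∀ t ∈ S, s ≠ t → Disjoint (B s) (B t))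
    Finset.card ⟨∅, by simp⟩
  simp only [Finset.mem_filter, Finset.mem_powerset] at hS hmax
  obtain ⟨hSG, hSd⟩ := hS
  have hnear : ∀ e ∈ G, ∃ s ∈ S, ¬ Disjoint (B e) (B s) := by
    intro e he
    by_contra hcon
    push Not at hcon
    have heS : e ∉ S := fun h => by
      have := hcon e h
      exact Finset.disjoint_left.1 this (hself e he) (hself e he)
    have := hmax (insert e S) ⟨by
      intro x hx
      rcases Finset.mem_insert.1 hx with rfl | hx
      · exact he
      · exact hSG hx, by
      intro s hs t ht hst
      rcases Finset.mem_insert.1 hs with h | hs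
      · rcases Finset.mem_insert.1 ht with h' | ht
        · exact absurd (h.trans h'.symm) hst
        · rw [h]; exact hcon t ht
      · rcases Finset.mem_insert.1 ht with h' | ht
        · rw [h']; exact (hcon s hs).symm
        · exact hSd s hs t ht hst⟩
    rw [Finset.card_insert_of_notMem heS] at this
    omega
  have hc : ∀ e : α, ∃ s : α, e ∈ G →
      s ∈ S ∧ ¬ Disjoint (B e) (B s) ∧ ∀ t ∈ S, e ∈ B t → s = t := by
    intro e
    by_cases he : e ∈ G
    · by_cases ht : ∃ t ∈ S, e ∈ B t
      · obtain ⟨t, htS, het⟩ := ht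
        refine ⟨t, fun _ => ⟨htS, fun h => Finset.disjoint_left.1 h (hself e he) het, ?_⟩⟩
        intro t' ht' het'
        by_contra hne
        exact Finset.disjoint_left.1 (hSd t htS t' ht' hne) het het'
      · obtain ⟨s, hs, hd⟩ := hnear e he
        exact ⟨s, fun _ => ⟨hs, hd, fun t htS het => absurd ⟨t, htS, het⟩ ht⟩⟩
    · exact ⟨e, fun h => absurd h he⟩
  choose c hc using hc
  have key : ∀ S' : Finset α, S' ⊆ S → Good Loc (G.filter fun e => c e ∈ S') := by
    intro S'
    induction S' using Finset.induction_on with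
    | empty => intro _; simpa using Good.empty Loc
    | insert s S' hs ih =>
      intro hsub
      have hsS : s ∈ S := hsub (Finset.mem_insert_self _ _)
      have hfib : Good Loc (G.filter fun e => c e = s) := by
        refine good_of_loc hmono _ _ rfl ?_ ?_
        · refine (h3 s (hSG hsS)).trans (Finset.card_le_card ?_)
          intro e he
          have heG := hB s (hSG hsS) he
          exact Finset.mem_filter.2 ⟨heG, (hc e heG).2.2 s hsS he⟩
        · refine hmono _ _ ?_ (hloc s (hSG hsS))
          intro e he
          obtain ⟨heG, hes⟩ := Finset.mem_filter.1 he
          refine Finset.mem_filter.2 ⟨heG, ?_⟩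
          rw [← hes]
          exact (hc e heG).2.1
      have := hfib.union (ih fun x hx => hsub (Finset.mem_insert_of_mem hx)) (by
        rw [Finset.disjoint_left]
        intro x hx hx'
        have h1 := (Finset.mem_filter.1 hx).2
        have h2 := (Finset.mem_filter.1 hx').2
        rw [h1] at h2
        exact hs h2)
      convert this using 1
      ext x
      simp only [Finset.mem_filter, Finset.mem_union, Finset.mem_insert]
      tauto
  have := key S (Finset.Subset.refl _)
  rwa [Finset.filter_true_of_mem (fun e he => (hc e he).1)] at this

end Abstract

section Lattice
variable {L q : ℕ}

/-- Decorated edges: position of the up-triangle, direction, and the two spins. -/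
abbrev DEdge (L q : ℕ) : Type := (ZMod L × ZMod L) × (Fin 3 × Fin q × Fin q)

/-- Offset of the down-triangle neighbour. -/
def off (L : ℕ) (k : Fin 3) : ZMod L × ZMod L :=
  if k = 0 then 0 else if k = 1 then (1, 0) else (0, 1)

/-- The decorated edge of `σ` at position `r`, direction `j`. -/
def dec (σ : Conf L q) (r : ZMod L × ZMod L) (j : Fin 3) : DEdge L q :=
  (r, j, σ (r, false), σ (r - off L j, true))

/-- Decorated domain wall of `σ`. -/
noncomputable def wall [NeZero L] (σ : Conf L q) : Finset (DEdge L q) :=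
  Finset.univ.filter fun x => x.2.2.1 = σ (x.1, false) ∧
    x.2.2.2 = σ (x.1 - off L x.2.1, true) ∧ x.2.2.1 ≠ x.2.2.2

lemma mem_wall [NeZero L] (σ : Conf L q) (x : DEdge L q) : x ∈ wall σ ↔
    x.2.2.1 = σ (x.1, false) ∧ x.2.2.2 = σ (x.1 - off L x.2.1, true) ∧ x.2.2.1 ≠ x.2.2.2 := by
  simp [wall]

lemma dec_mem_wall [NeZero L] (σ : Conf L q) (r j) :
    dec σ r j ∈ wall σ ↔ σ (r, false) ≠ σ (r - off L j, true) := by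
  simp [mem_wall, dec]

lemma eq_dec_of_mem [NeZero L] (σ : Conf L q) (x : DEdge L q) (hx : x ∈ wall σ) :
    x = dec σ x.1 x.2.1 := by
  obtain ⟨p, k, a, b⟩ := x
  obtain ⟨h1, h2, -⟩ := (mem_wall _ _).1 hx
  simp only at h1 h2
  simp [dec, h1, h2]

lemma off_inj (hL : 8 ≤ L) : Function.Injective (off L) := by
  have : Fact (1 < L) := ⟨by omega⟩
  intro a b h
  fin_cases a <;> fin_cases b <;> simp [off, Prod.ext_iff] at h ⊢

lemma card_wall [NeZero L] (hL : 8 ≤ L) (σ : Conf L q) : (wall σ).card = Ham L q σ := by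
  rw [Ham, ← Nat.card_eq_finsetCard]
  refine Nat.card_congr (Equiv.ofBijective (fun x => ⟨((x.1.1, false),
    (x.1.1 - off L x.1.2.1, true)), rfl, ?_, ?_⟩) ⟨?_, ?_⟩)
  · refine Or.inl ⟨rfl, rfl, ?_⟩
    obtain ⟨⟨⟨p1, p2⟩, k, a, b⟩, hx⟩ := x
    fin_cases k <;> simp [off]
  · obtain ⟨h1, h2, h3⟩ := (mem_wall _ _).1 x.2
    simpa [← h1, ← h2] using h3
  · rintro ⟨x, hx⟩ ⟨y, hy⟩ h
    simp only [Subtype.mk.injEq, Prod.mk.injEq, and_true] at h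
    obtain ⟨h1, h2⟩ := h
    rw [h1] at h2
    have h3 := off_inj hL (sub_right_injective h2)
    apply Subtype.ext
    show x = y
    rw [eq_dec_of_mem σ x hx, eq_dec_of_mem σ y hy, h1, h3]
  · rintro ⟨⟨⟨p, s⟩, ⟨r, t⟩⟩, h1, h2, h3⟩
    simp only at h1
    subst h1
    rcases h2 with ⟨-, ht, h2⟩ | ⟨h2, -⟩
    · simp only at ht h2
      subst ht
      have : ∃ k : Fin 3, r = p - off L k := by
        rcases h2 with h | h | h
        · exact ⟨0, by simp [h, off]⟩
        · exact ⟨1, by rw [h]; ext <;> simp [off]⟩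
        · exact ⟨2, by rw [h]; ext <;> simp [off]⟩
      obtain ⟨k, rfl⟩ := this
      exact ⟨⟨dec σ p k, (dec_mem_wall _ _ _).2 h3⟩, rfl⟩
    · simp at h2

/-- The lattice is connected: a nonempty set of sites closed under adjacency is everything. -/
lemma all_of_closed [NeZero L] (A : Site L → Prop)
    (hA : ∀ p k, A (p, false) ↔ A (p - off L k, true)) (x : Site L) (hx : A x) (y : Site L) :
    A y := by
  have step1 : ∀ p : ZMod L × ZMod L, A (p, false) → A ((p.1 + 1, p.2), false) := by
    intro p hp
    have h := (hA p 0).1 hp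
    rw [hA (p.1 + 1, p.2) 1]
    simpa [off] using h
  have step2 : ∀ p : ZMod L × ZMod L, A (p, false) → A ((p.1, p.2 + 1), false) := by
    intro p hp
    have h := (hA p 0).1 hp
    rw [hA (p.1, p.2 + 1) 2]
    simpa [off] using h
  have down : ∀ p, A (p, false) ↔ A (p, true) := fun p => by
    have := hA p 0
    rwa [show p - off L 0 = p by simp [off]] at this
  have s1 : ∀ (n : ℕ) (p : ZMod L × ZMod L), A (p, false) → A ((p.1 + n, p.2), false) := by
    intro n p hp
    induction n with
    | zero => simpa using hp
    | succ n ih => have := step1 _ ih; simpa [add_assoc] using this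
  have s2 : ∀ (n : ℕ) (p : ZMod L × ZMod L), A (p, false) → A ((p.1, p.2 + n), false) := by
    intro n p hp
    induction n with
    | zero => simpa using hp
    | succ n ih => have := step2 _ ih; simpa [add_assoc] using this
  have hx0 : A (x.1, false) := by
    obtain ⟨p, b⟩ := x
    cases b
    · exact hx
    · exact (down p).2 hx
  have hy0 : A (y.1, false) := by
    have := s2 (y.1.2 - x.1.2).val _ (s1 (y.1.1 - x.1.1).val _ hx0)
    simpa using this
  obtain ⟨p, b⟩ := y
  cases b
  · exact hy0
  · exact (down p).1 hy0

lemma wall_inj [NeZero L] (σ τ : Conf L q) (h : wall σ = wall τ) (hne : (wall σ).Nonempty) :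
    σ = τ := by
  by_contra hcon
  obtain ⟨x, hx⟩ := Function.ne_iff.1 hcon
  have hmem : ∀ p k, σ (p, false) ≠ σ (p - off L k, true) →
      σ (p, false) = τ (p, false) ∧ σ (p - off L k, true) = τ (p - off L k, true) := by
    intro p k hpk
    have h1 := (dec_mem_wall σ p k).2 hpk
    rw [h, mem_wall] at h1
    exact ⟨h1.1, h1.2.1⟩
  have hmem' : ∀ p k, τ (p, false) ≠ τ (p - off L k, true) →
      σ (p, false) = τ (p, false) ∧ σ (p - off L k, true) = τ (p - off L k, true) := by
    intro p k hpk
    have h1 := (dec_mem_wall τ p k).2 hpk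
    rw [← h, mem_wall] at h1
    exact ⟨h1.1.symm, h1.2.1.symm⟩
  have hall := all_of_closed (fun s => σ s ≠ τ s) (fun p k => by
    have h1 := hmem p k
    have h2 := hmem' p k
    grind) x hx
  obtain ⟨e, he⟩ := hne
  have hedge := he
  rw [eq_dec_of_mem σ e he, dec_mem_wall] at hedge
  exact hall _ (hmem _ _ hedge).1

/-- Closeness of positions. -/
def close (p r : ZMod L × ZMod L) : Prop :=
  ∃ a b : ℤ, |a| ≤ 1 ∧ |b| ≤ 1 ∧ r = (p.1 + a, p.2 + b)

lemma cast_inj_small (hL : 8 ≤ L) (a a' : ℤ) (ha : |a| ≤ 1) (ha' : |a'| ≤ 1)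
    (h : (a : ZMod L) = a') : a = a' := by
  rw [ZMod.intCast_eq_intCast_iff_dvd_sub] at h
  rw [abs_le] at ha ha'
  have := Int.eq_zero_of_abs_lt_dvd h (by rw [abs_lt]; constructor <;> omega)
  omega

/-- Other edges at the first endpoint of a dual edge (relative coordinates). -/
def nb1 (k : Fin 3) : List (ℤ × ℤ × Fin 3) :=
  if k = 0 then [(1, 0, 1), (0, 0, 2), (1, -1, 1), (1, -1, 0), (1, 0, 2)]
  else if k = 1 then [(0, 0, 2), (-1, 0, 0), (0, -1, 0), (-1, 0, 2), (0, -1, 1)]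
  else [(0, 0, 1), (-1, 0, 0), (0, -1, 0), (-1, 0, 2), (0, -1, 1)]

/-- Other edges at the second endpoint of a dual edge (relative coordinates). -/
def nb2 (k : Fin 3) : List (ℤ × ℤ × Fin 3) :=
  if k = 0 then [(0, 1, 1), (-1, 1, 0), (-1, 1, 2), (0, 0, 1), (0, 1, 2)]
  else if k = 1 then [(0, 1, 1), (-1, 1, 0), (-1, 1, 2), (0, 0, 0), (0, 1, 2)]
  else [(1, 0, 1), (0, 0, 0), (1, -1, 1), (1, -1, 0), (1, 0, 2)]

/-- The decorated edge at relative coordinates `t`. -/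
def rel (σ : Conf L q) (p : ZMod L × ZMod L) (t : ℤ × ℤ × Fin 3) : DEdge L q :=
  dec σ (p.1 + t.1, p.2 + t.2.1) t.2.2

lemma exists_nb1 [NeZero L] (σ : Conf L q) (p : ZMod L × ZMod L) (k : Fin 3)
    (h : dec σ p k ∈ wall σ) : ∃ t ∈ nb1 k, rel σ p t ∈ wall σ := by
  obtain ⟨p1, p2⟩ := p
  by_contra hcon
  push Not at hcon
  simp only [rel, dec_mem_wall, not_not] at h hcon
  fin_cases k <;> simp [nb1, off] at h hcon <;> ring_nf at hcon <;>
    (try ring_nf at h) <;> grind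

lemma exists_nb2 [NeZero L] (σ : Conf L q) (p : ZMod L × ZMod L) (k : Fin 3)
    (h : dec σ p k ∈ wall σ) : ∃ t ∈ nb2 k, rel σ p t ∈ wall σ := by
  obtain ⟨p1, p2⟩ := p
  by_contra hcon
  push Not at hcon
  simp only [rel, dec_mem_wall, not_not] at h hcon
  fin_cases k <;> simp [nb2, off] at h hcon <;> ring_nf at hcon <;>
    (try ring_nf at h) <;> grind

lemma nb_small : ∀ k : Fin 3, ∀ t ∈ nb1 k ++ nb2 k ++ [(0, 0, k)], |t.1| ≤ 1 ∧ |t.2.1| ≤ 1 := by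
  decide

lemma nb_ne : ∀ k : Fin 3, (0, 0, k) ∉ nb1 k ∧ (0, 0, k) ∉ nb2 k ∧
    ∀ t ∈ nb1 k, t ∉ nb2 k := by
  decide

lemma rel_inj (hL : 8 ≤ L) (σ : Conf L q) (p : ZMod L × ZMod L) (t s : ℤ × ℤ × Fin 3)
    (ht : |t.1| ≤ 1 ∧ |t.2.1| ≤ 1) (hs : |s.1| ≤ 1 ∧ |s.2.1| ≤ 1)
    (h : rel σ p t = rel σ p s) : t = s := by
  obtain ⟨a, b, j⟩ := t
  obtain ⟨a', b', j'⟩ := s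
  simp only [rel, dec, Prod.mk.injEq, add_right_inj] at h
  rw [cast_inj_small hL a a' ht.1 hs.1 h.1.1, cast_inj_small hL b b' ht.2 hs.2 h.1.2, h.2.1]

/-- Ball of a decorated edge in the wall. -/
noncomputable def ball [NeZero L] (σ : Conf L q) (e : DEdge L q) : Finset (DEdge L q) :=
  (wall σ).filter fun x => close e.1 x.1

lemma ball_card [NeZero L] (hL : 8 ≤ L) (σ : Conf L q) (e : DEdge L q) (he : e ∈ wall σ) :
    3 ≤ (ball σ e).card := by
  have he2 := he
  rw [eq_dec_of_mem σ e he] at he2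
  obtain ⟨t, ht, htw⟩ := exists_nb1 σ _ _ he2
  obtain ⟨s, hs, hsw⟩ := exists_nb2 σ _ _ he2
  have hsm := nb_small e.2.1
  have hne := nb_ne e.2.1
  have ht1 := hsm t (by simp [ht])
  have hs1 := hsm s (by simp [hs])
  have h01 := hsm (0, 0, e.2.1) (by simp)
  have he0 : e = rel σ e.1 (0, 0, e.2.1) := by
    conv_lhs => rw [eq_dec_of_mem σ e he]
    simp [rel]
  refine Finset.two_lt_card.2 ⟨rel σ e.1 (0, 0, e.2.1), ?_, rel σ e.1 t, ?_, rel σ e.1 s, ?_,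
    ?_, ?_, ?_⟩
  · exact Finset.mem_filter.2 ⟨by rw [← he0]; exact he, _, _, h01.1, h01.2, rfl⟩
  · exact Finset.mem_filter.2 ⟨htw, _, _, ht1.1, ht1.2, rfl⟩
  · exact Finset.mem_filter.2 ⟨hsw, _, _, hs1.1, hs1.2, rfl⟩
  · intro h
    have := rel_inj hL σ _ _ _ h01 ht1 h
    exact hne.1 (this ▸ ht)
  · intro h
    have := rel_inj hL σ _ _ _ h01 hs1 h
    exact hne.2.1 (this ▸ hs)
  · intro h
    have := rel_inj hL σ _ _ _ ht1 hs1 h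
    exact hne.2.2 t ht (this ▸ hs)

/-- Decode a local piece from a base point and a shape. -/
noncomputable def decode (T : (ZMod L × ZMod L) ×
    Finset ((Fin 5 × Fin 5) × (Fin 3 × Fin q × Fin q))) : Finset (DEdge L q) :=
  T.2.image fun y => ((T.1.1 + ((y.1.1 : ℕ) : ZMod L), T.1.2 + ((y.1.2 : ℕ) : ZMod L)), y.2)

/-- All local pieces. -/
noncomputable def pieces (L q : ℕ) [NeZero L] : Finset (Finset (DEdge L q)) :=
  Finset.univ.image decode

lemma card_pieces [NeZero L] : (pieces L q).card ≤ 2 ^ (75 * q ^ 2) * L ^ 2 := by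
  refine Finset.card_image_le.trans (le_of_eq ?_)
  rw [Finset.card_univ, Fintype.card_prod, Fintype.card_prod, Fintype.card_finset]
  simp only [Fintype.card_prod, Fintype.card_fin, ZMod.card]
  rw [show 5 * 5 * (3 * (q * q)) = 75 * q ^ 2 by ring]
  ring

/-- Locality: contained in a `5 × 5` box. -/
def Loc (p : Finset (DEdge L q)) : Prop :=
  ∃ c : ZMod L × ZMod L, ∀ x ∈ p, ∃ a b : Fin 5,
    x.1 = (c.1 + ((a : ℕ) : ZMod L), c.2 + ((b : ℕ) : ZMod L))

lemma mem_pieces_of_loc [NeZero L] (p : Finset (DEdge L q)) (h : Loc p) : p ∈ pieces L q := by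
  obtain ⟨c, hc⟩ := h
  refine Finset.mem_image.2 ⟨(c, Finset.univ.filter fun y =>
    (((c.1 + ((y.1.1 : ℕ) : ZMod L), c.2 + ((y.1.2 : ℕ) : ZMod L)), y.2) : DEdge L q) ∈ p),
    Finset.mem_univ _, ?_⟩
  ext x
  simp only [decode, Finset.mem_image, Finset.mem_filter, Finset.mem_univ, true_and]
  constructor
  · rintro ⟨y, hy, rfl⟩
    exact hy
  · intro hx
    obtain ⟨a, b, hab⟩ := hc x hx
    refine ⟨((a, b), x.2), ?_, ?_⟩
    · simp only
      rw [← hab]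
      exact hx
    · simp only
      rw [← hab]

lemma small_fin (m : ℤ) (h : |m| ≤ 2) (u : ZMod L) :
    ∃ a : Fin 5, u + (m : ZMod L) = u - 2 + ((a : ℕ) : ZMod L) := by
  rw [abs_le] at h
  obtain ⟨n, hn⟩ := Int.eq_ofNat_of_zero_le (show 0 ≤ m + 2 by omega)
  refine ⟨⟨n, by omega⟩, ?_⟩
  have h2 : (m : ZMod L) + 2 = n := by exact_mod_cast congrArg (Int.cast : ℤ → ZMod L) hn
  simp only
  rw [← h2]
  ring

lemma wall_good [NeZero L] (hL : 8 ≤ L) (σ : Conf L q) : Good Loc (wall σ) := by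
  refine good_of_balls ?_ (wall σ) (ball σ) (fun e _ => Finset.filter_subset _ _) ?_
    (fun e he => ball_card hL σ e he) ?_
  · rintro p p' hpp ⟨c, hc⟩
    exact ⟨c, fun x hx => hc x (hpp hx)⟩
  · intro e he
    exact Finset.mem_filter.2 ⟨he, 0, 0, by simp, by simp, by simp⟩
  · intro s hs
    refine ⟨(s.1.1 - 2, s.1.2 - 2), ?_⟩
    intro x hx
    simp only [Finset.mem_filter] at hx
    obtain ⟨z, hz1, hz2⟩ := Finset.not_disjoint_iff.1 hx.2
    obtain ⟨a, b, ha, hb, h1⟩ := (Finset.mem_filter.1 hz1).2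
    obtain ⟨a', b', ha', hb', h2⟩ := (Finset.mem_filter.1 hz2).2
    rw [h1, Prod.mk.injEq] at h2
    obtain ⟨i, hi⟩ := small_fin (L := L) (a' - a) (by rw [abs_le] at *; omega) s.1.1
    obtain ⟨j, hj⟩ := small_fin (L := L) (b' - b) (by rw [abs_le] at *; omega) s.1.2
    refine ⟨i, j, ?_⟩
    push_cast at hi hj
    ext
    · simp only
      rw [← hi]
      linear_combination h2.1
    · simp only
      rw [← hj]
      linear_combination h2.2

end Lattice

/-- Lemma 4.2(1) (hexagonal lattice): there is an integer `θ > 1`, independent of `L`,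
such that `|X_i| ≤ q^{i+1} Σ_{3n₃+4n₄+5n₅+6n₆ = i} C(θL²,n₃)C(θL²,n₄)C(θL²,n₅)C(θL²,n₆)`. -/
theorem config_count_upper (q : ℕ) (hq : 2 ≤ q) :
    ∃ θ : ℕ, 1 < θ ∧ ∀ L : ℕ, 8 ≤ L → ∀ i : ℕ, 1 ≤ i →
      Nat.card {σ : Conf L q // Ham L q σ = i} ≤
        q ^ (i + 1) *
          ∑ n ∈ (((Finset.range (i + 1) ×ˢ Finset.range (i + 1)) ×ˢ
              (Finset.range (i + 1) ×ˢ Finset.range (i + 1))).filter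
              fun n => 3 * n.1.1 + 4 * n.1.2 + 5 * n.2.1 + 6 * n.2.2 = i),
            (θ * L ^ 2).choose n.1.1 * (θ * L ^ 2).choose n.1.2 *
              (θ * L ^ 2).choose n.2.1 * (θ * L ^ 2).choose n.2.2 := by
  refine ⟨2 ^ (75 * q ^ 2), Nat.one_lt_two_pow (by positivity), ?_⟩
  intro L hL i hi
  have : NeZero L := ⟨by omega⟩
  set M := 2 ^ (75 * q ^ 2) * L ^ 2 with hM
  refine le_trans ?_ (Nat.le_mul_of_pos_left _ (by positivity))
  choose P hP hPu hPs using fun σ : Conf L q => wall_good hL σ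
  let F : Conf L q → (Finset (Finset (DEdge L q)) × Finset (Finset (DEdge L q))) ×
      (Finset (Finset (DEdge L q)) × Finset (Finset (DEdge L q))) := fun σ =>
    (((P σ).filter (fun p => p.card = 3), (P σ).filter (fun p => p.card = 4)),
      ((P σ).filter (fun p => p.card = 5), (P σ).filter (fun p => p.card = 6)))
  have hsplit : ∀ σ, P σ = ((F σ).1.1 ∪ (F σ).1.2) ∪ ((F σ).2.1 ∪ (F σ).2.2) := by
    intro σ
    ext p
    simp only [F, Finset.mem_union, Finset.mem_filter]
    constructor
    · intro hp
      have h1 := hP σ p hp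
      have : p.card = 3 ∨ p.card = 4 ∨ p.card = 5 ∨ p.card = 6 := by omega
      tauto
    · tauto
  have hsum : ∀ σ, 3 * (F σ).1.1.card + 4 * (F σ).1.2.card + 5 * (F σ).2.1.card +
      6 * (F σ).2.2.card = Ham L q σ := by
    intro σ
    rw [← card_wall hL, ← hPs σ]
    have h1 : ∀ p ∈ P σ, p.card = 3 * (if p.card = 3 then 1 else 0) +
        4 * (if p.card = 4 then 1 else 0) + 5 * (if p.card = 5 then 1 else 0) +
        6 * (if p.card = 6 then 1 else 0) := by
      intro p hp
      have h1 := hP σ p hp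
      have : p.card = 3 ∨ p.card = 4 ∨ p.card = 5 ∨ p.card = 6 := by omega
      rcases this with h | h | h | h <;> simp [h]
    rw [Finset.sum_congr rfl h1]
    simp only [F, Finset.sum_add_distrib, ← Finset.mul_sum, Finset.card_filter]
  have hsub : ∀ σ, ∀ p ∈ P σ, p ∈ pieces L q := fun σ p hp =>
    mem_pieces_of_loc p (hP σ p hp).2.2
  rw [Nat.card_eq_fintype_card, Fintype.card_subtype]
  set N := (((Finset.range (i + 1) ×ˢ Finset.range (i + 1)) ×ˢ
              (Finset.range (i + 1) ×ˢ Finset.range (i + 1))).filter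
              fun n => 3 * n.1.1 + 4 * n.1.2 + 5 * n.2.1 + 6 * n.2.2 = i) with hN
  calc _ ≤ (N.biUnion fun n =>
        ((pieces L q).powersetCard n.1.1 ×ˢ (pieces L q).powersetCard n.1.2) ×ˢ
        ((pieces L q).powersetCard n.2.1 ×ˢ (pieces L q).powersetCard n.2.2)).card := by
        refine Finset.card_le_card_of_injOn F ?_ ?_
        · intro σ hσ
          have hσ' : Ham L q σ = i := by simpa using hσ
          have h1 := hsum σ
          rw [hσ'] at h1
          refine Finset.mem_coe.2 (Finset.mem_biUnion.2
            ⟨(((F σ).1.1.card, (F σ).1.2.card), ((F σ).2.1.card, (F σ).2.2.card)), ?_, ?_⟩)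
          · simp only [hN, Finset.mem_filter, Finset.mem_product, Finset.mem_range]
            refine ⟨⟨⟨?_, ?_⟩, ?_, ?_⟩, h1⟩ <;> omega
          · simp only [Finset.mem_product, Finset.mem_powersetCard, and_true]
            refine ⟨⟨?_, ?_⟩, ?_, ?_⟩ <;>
              exact fun p hp => hsub σ p (Finset.mem_filter.1 hp).1
        · intro σ hσ τ hτ h
          have hσ' : Ham L q σ = i := by simpa using hσ
          have hPP : P σ = P τ := by rw [hsplit σ, hsplit τ, h]
          refine wall_inj σ τ ?_ ?_
          · rw [← hPu σ, ← hPu τ, hPP]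
          · rw [← Finset.card_pos, card_wall hL]
            omega
    _ ≤ _ := by
        refine Finset.card_biUnion_le.trans (Finset.sum_le_sum ?_)
        intro n _
        simp only [Finset.card_product, Finset.card_powersetCard]
        rw [← mul_assoc]
        have hc : ∀ k, (pieces L q).card.choose k ≤ M.choose k := fun k =>
          Nat.choose_le_choose k card_pieces
        exact Nat.mul_le_mul (Nat.mul_le_mul (Nat.mul_le_mul (hc _) (hc _)) (hc _)) (hc _)

end IsingHex
end
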